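/- Let D be a four-element type of directions {u, d, l, r}, let opp : D → D be the involution with opp(u) = d, opp(d) = u, opp(l) = r, opp(r) = l, and let T be the six-symbol terminal alphabet consisting of the four directions together with two markers t (treasure) and x (exit). Consider the context-free grammar over T with nonterminals S (the start symbol) and P and productions S → P x and P → u P d | d P u | l P r | r P l | t. Then the language generated by this grammar equals { w.map dir ++ [t] ++ ((w.map opp).map dir).reverse ++ [x] | w : List D }, where dir embeds directions into T; that is, it consists exactly of the words encoding a path w, then the treasure, then the reversed path with each direction replaced by its opposite, then the exit. -/

import Mathlib

/-- The four directions up, down, left, right. -/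
inductive Dir : Type
  | u | d | l | r
deriving DecidableEq

/-- The involution sending each direction to its opposite. -/
def opp : Dir → Dir
  | .u => .d
  | .d => .u
  | .l => .r
  | .r => .l

/-- The six-symbol terminal alphabet: the four directions, the treasure marker `t`,
and the exit marker `x`. -/
inductive Tm : Type
  | dir : Dir → Tm
  | t | x
deriving DecidableEq

/-- The nonterminals `S` (start symbol) and `P` of the maze grammar. -/
inductive Nt : Type
  | S | P
deriving DecidableEq

instance : DecidableEq (ContextFreeRule Tm Nt) := fun r s =>
  decidable_of_iff (r.input = s.input ∧ r.output = s.output) (ContextFreeRule.ext_iff).symm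

open Symbol in
/-- The maze grammar with productions `S → P x` and
`P → u P d | d P u | l P r | r P l | t`. -/
def mazeGrammar : ContextFreeGrammar Tm where
  NT := Nt
  initial := Nt.S
  rules :=
    { ⟨Nt.S, [nonterminal Nt.P, terminal Tm.x]⟩,
      ⟨Nt.P, [terminal (Tm.dir .u), nonterminal Nt.P, terminal (Tm.dir .d)]⟩,
      ⟨Nt.P, [terminal (Tm.dir .d), nonterminal Nt.P, terminal (Tm.dir .u)]⟩,
      ⟨Nt.P, [terminal (Tm.dir .l), nonterminal Nt.P, terminal (Tm.dir .r)]⟩,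
      ⟨Nt.P, [terminal (Tm.dir .r), nonterminal Nt.P, terminal (Tm.dir .l)]⟩,
      ⟨Nt.P, [terminal Tm.t]⟩ }

open Symbol

theorem mem_mazeGrammar_rules {r : ContextFreeRule Tm Nt} :
    r ∈ mazeGrammar.rules ↔ r = ⟨Nt.S, [nonterminal Nt.P, terminal Tm.x]⟩ ∨
      (∃ a, r = ⟨Nt.P, [terminal (Tm.dir a), nonterminal Nt.P, terminal (Tm.dir (opp a))]⟩) ∨
      r = ⟨Nt.P, [terminal Tm.t]⟩ := by
  change r ∈ Insert.insert (γ := Finset (ContextFreeRule Tm Nt)) _ _ ↔ _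
  simp only [Finset.mem_insert, Finset.mem_singleton]
  constructor
  · rintro (h | h | h | h | h | h)
    · exact .inl h
    · exact .inr (.inl ⟨.u, h⟩)
    · exact .inr (.inl ⟨.d, h⟩)
    · exact .inr (.inl ⟨.l, h⟩)
    · exact .inr (.inl ⟨.r, h⟩)
    · exact .inr (.inr h)
  · rintro (h | ⟨_ | _ | _ | _, h⟩ | h) <;> simp [h, opp]

/-- The sentential form consisting of the path `w`, then `m`, then the retraced path and the
exit. -/
def mazeForm (w : List Dir) (m : List (Symbol Tm Nt)) : List (Symbol Tm Nt) :=
  (w.map Tm.dir).map terminal ++ m ++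
    ((((w.map opp).map Tm.dir).reverse ++ [Tm.x]).map terminal)

theorem mazeForm_concat (w : List Dir) (a : Dir) (m : List (Symbol Tm Nt)) :
    mazeForm (w ++ [a]) m =
      mazeForm w ([terminal (Tm.dir a)] ++ m ++ [terminal (Tm.dir (opp a))]) := by
  simp [mazeForm]

theorem map_terminal_mazeWord (w : List Dir) :
    (w.map Tm.dir ++ [Tm.t] ++ ((w.map opp).map Tm.dir).reverse ++ [Tm.x]).map terminal =
      mazeForm w [terminal Tm.t] := by
  simp [mazeForm]

theorem produces_mazeForm {r : ContextFreeRule Tm Nt} (hr : r ∈ mazeGrammar.rules)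
    (hP : r.input = Nt.P) (w : List Dir) :
    mazeGrammar.Produces (mazeForm w [nonterminal Nt.P]) (mazeForm w r.output) :=
  ⟨r, hr, by rw [← hP]; exact r.rewrites_of_exists_parts _ _⟩

theorem derives_mazeForm (w : List Dir) :
    mazeGrammar.Derives [nonterminal Nt.S] (mazeForm w [nonterminal Nt.P]) := by
  induction w using List.reverseRecOn with
  | nil =>
    exact ContextFreeGrammar.Produces.single
      ⟨_, mem_mazeGrammar_rules.2 (.inl rfl), ContextFreeRule.Rewrites.input_output⟩
  | append_singleton w a ih =>
    rw [mazeForm_concat]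
    exact ih.trans_produces
      (produces_mazeForm (mem_mazeGrammar_rules.2 (.inr (.inl ⟨a, rfl⟩))) rfl w)

theorem eq_mazeForm_of_rewrites {r : ContextFreeRule Tm Nt} {w : List Dir}
    {m : Symbol Tm Nt} {v : List (Symbol Tm Nt)} (h : r.Rewrites (mazeForm w [m]) v) :
    m = nonterminal r.input ∧ v = mazeForm w r.output := by
  obtain ⟨p, q, hu, rfl⟩ := h.exists_parts
  simp only [mazeForm, List.append_assoc, List.singleton_append] at hu
  rw [List.append_cons_inj_of_notMem (by simp) (by simp)] at hu
  obtain ⟨rfl, rfl, rfl⟩ := hu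
  simp [mazeForm]

theorem ContextFreeRule.Rewrites.eq_of_singleton {T N : Type*} {r : ContextFreeRule T N} {A : N}
    {v : List (Symbol T N)} (h : r.Rewrites [nonterminal A] v) : r.input = A ∧ v = r.output := by
  obtain ⟨p, q, hu, rfl⟩ := h.exists_parts
  cases p <;> simp_all

theorem eq_mazeForm_of_derives {v : List (Symbol Tm Nt)}
    (h : mazeGrammar.Derives [nonterminal Nt.S] v) :
    v = [nonterminal Nt.S] ∨ ∃ w, v = mazeForm w [nonterminal Nt.P] ∨
      v = mazeForm w [terminal Tm.t] := by
  induction h with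
  | refl => exact .inl rfl
  | tail _ hp ih =>
    obtain ⟨r, hr, hrw⟩ := hp
    right
    rcases ih with rfl | ⟨w, rfl | rfl⟩
    · obtain ⟨hS, rfl⟩ := hrw.eq_of_singleton
      rcases mem_mazeGrammar_rules.1 hr with rfl | ⟨a, rfl⟩ | rfl
      · exact ⟨[], .inl rfl⟩
      · cases hS
      · cases hS
    · obtain ⟨hP, rfl⟩ := eq_mazeForm_of_rewrites hrw
      rcases mem_mazeGrammar_rules.1 hr with rfl | ⟨a, rfl⟩ | rfl
      · cases hP
      · exact ⟨w ++ [a], .inl (mazeForm_concat w a [nonterminal Nt.P]).symm⟩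
      · exact ⟨w, .inr rfl⟩
    · cases (eq_mazeForm_of_rewrites hrw).1

/-- The language of the maze grammar consists exactly of the words encoding a path `w`,
then the treasure `t`, then the reversed path with each direction replaced by its
opposite, then the exit `x`. -/
theorem mazeGrammar_language :
    mazeGrammar.language =
      { l : List Tm | ∃ w : List Dir,
          l = w.map Tm.dir ++ [Tm.t] ++ ((w.map opp).map Tm.dir).reverse ++ [Tm.x] } := by
  ext l
  change mazeGrammar.Derives [nonterminal Nt.S] (l.map terminal) ↔ ∃ w : List Dir, _
  constructor
  · intro h
    have hn (A : Nt) : nonterminal A ∉ l.map (terminal (N := Nt)) := by simp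
    rcases eq_mazeForm_of_derives h with h | ⟨w, h | h⟩
    · exact absurd (h ▸ List.mem_singleton_self _) (hn Nt.S)
    · exact absurd (h ▸ by simp [mazeForm]) (hn Nt.P)
    · refine ⟨w, List.map_injective_iff.2 (fun _ _ => Symbol.terminal.inj (N := Nt)) ?_⟩
      exact h.trans (map_terminal_mazeWord w).symm
  · rintro ⟨w, rfl⟩
    have h := (derives_mazeForm w).trans_produces
      (produces_mazeForm (mem_mazeGrammar_rules.2 (.inr (.inr rfl))) rfl w)
    rw [← map_terminal_mazeWord] at h
    exact h
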